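/- Let Ω be an open set in ℝⁿ, n ≥ 3, and let f: Ω → ℝⁿ be a continuous open mapping in the Orlicz–Sobolev class W^{1,φ}_loc(Ω), where φ: [0,∞) → [0,∞) is increasing and satisfies the Calderon-type condition ∫₁^∞ (t/φ(t))^{1/(n−2)} dt < ∞. Then f has a total differential at almost every point of Ω. -/

import Mathlib

open MeasureTheory Set Metric Topology ENNReal

noncomputable section

abbrev Euc (n : ℕ) : Type := EuclideanSpace ℝ (Fin n)

/-- `Df` is a weak (distributional) Jacobian of `f` on the open set `Ω`, and both `f` and
`Df` are locally integrable on `Ω`; this encodes `f ∈ W^{1,1}_loc(Ω)` with weak derivative `Df`. -/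
def IsWeakFDerivOn {n m : ℕ} (Ω : Set (Euc n)) (f : Euc n → Euc m)
    (Df : Euc n → (Euc n →L[ℝ] Euc m)) : Prop :=
  LocallyIntegrableOn f Ω volume ∧
  LocallyIntegrableOn (fun x => Df x) Ω volume ∧
  ∀ ψ : Euc n → ℝ, ContDiff ℝ (⊤ : ℕ∞) ψ → HasCompactSupport ψ → tsupport ψ ⊆ Ω →
    ∀ v : Euc n, ∫ x in Ω, ψ x • Df x v = - ∫ x in Ω, (fderiv ℝ ψ x v) • f x

/-- The "gradient norm" `|∇f| = sqrt (Σ_{i,j} (∂f_i/∂x_j)²)` of a Jacobian matrix. -/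
def frobNorm {n m : ℕ} (A : Euc n →L[ℝ] Euc m) : ℝ :=
  Real.sqrt (∑ i : Fin m, ∑ j : Fin n, (A (EuclideanSpace.single j (1:ℝ)) i) ^ 2)

/-- The Calderón-type condition `∫₁^∞ (t/φ(t))^{1/(n-2)} dt < ∞`. -/
def CalderonCondition (n : ℕ) (φ : ℝ → ℝ) : Prop :=
  ∫⁻ t in Ioi (1:ℝ), (ENNReal.ofReal t / ENNReal.ofReal (φ t)) ^ (1 / ((n : ℝ) - 2)) < ⊤

/-- `f` belongs to the Orlicz–Sobolev class `W^{1,φ}_loc(Ω)` with weak Jacobian `Df`. -/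
def MemOrliczSobolevWith {n m : ℕ} (φ : ℝ → ℝ) (Ω : Set (Euc n)) (f : Euc n → Euc m)
    (Df : Euc n → (Euc n →L[ℝ] Euc m)) : Prop :=
  IsWeakFDerivOn Ω f Df ∧
  ∀ K : Set (Euc n), K ⊆ Ω → IsCompact K →
    ∫⁻ x in K, ENNReal.ofReal (φ (frobNorm (Df x))) ∂volume < ⊤


/-! ### Stepanov's theorem -/

section Stepanov

variable {E F : Type*} [NormedAddCommGroup E] [NormedSpace ℝ E] [FiniteDimensional ℝ E]
  [NormedAddCommGroup F] [NormedSpace ℝ F]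

/-- If `f` has linear growth around every point of `T`, at a scale larger than the diameter of
`T`, then `f` is differentiable at almost every point of `T`. -/
theorem ae_differentiableAt_of_uniform_linear_growth [FiniteDimensional ℝ F]
    [MeasurableSpace E] [BorelSpace E]
    (μ : Measure E) [μ.IsAddHaarMeasure] {f : E → F} {T : Set E} {C δ : ℝ} (hC : 0 ≤ C)
    (hδ : 0 < δ) (hT : ∀ x ∈ T, ∀ y ∈ T, dist x y < δ)
    (hf : ∀ x ∈ T, ∀ y ∈ ball x δ, ‖f y - f x‖ ≤ C * ‖y - x‖) :
    ∀ᵐ x ∂μ, x ∈ T → DifferentiableAt ℝ f x := by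
  have hlip : LipschitzOnWith (Real.toNNReal C) f T := by
    refine LipschitzOnWith.of_dist_le_mul fun y hy x hx => ?_
    rw [Real.coe_toNNReal _ hC, dist_eq_norm, dist_eq_norm]
    exact hf x hx y (mem_ball.2 (hT y hy x hx))
  obtain ⟨g, hg, hgf⟩ := hlip.extend_finite_dimension
  set L : NNReal := lipschitzExtensionConstant F * Real.toNNReal C with hL
  have hdist : LipschitzWith 1 (fun x : E => infDist x T) := lipschitz_infDist_pt T
  filter_upwards [hg.ae_differentiableAt (μ := μ), hdist.ae_differentiableAt (μ := μ)]
    with x hgx hdx hxT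
  have hmin : IsLocalMin (fun x : E => infDist x T) x := by
    refine Filter.Eventually.of_forall fun y => ?_
    simp only [infDist_zero_of_mem hxT]
    exact infDist_nonneg
  have hd0 : HasFDerivAt (fun x : E => infDist x T) (0 : E →L[ℝ] ℝ) x := by
    simpa [hmin.fderiv_eq_zero] using hdx.hasFDerivAt
  have hdo : (fun y => infDist y T) =o[𝓝 x] fun y => y - x := by
    simpa [infDist_zero_of_mem hxT] using hd0.isLittleO
  have hbound : ∀ y ∈ ball x (δ / 2), ‖f y - g y‖ ≤ (C + L) * infDist y T := by
    intro y hy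
    have hyd : infDist y T < δ / 2 :=
      (infDist_le_dist_of_mem hxT).trans_lt (mem_ball.1 hy)
    refine le_of_forall_pos_le_add fun ε hε => ?_
    have hCL : 0 ≤ C + (L : ℝ) := by positivity
    obtain ⟨η, hη, hη1, hη2⟩ : ∃ η > 0, infDist y T + η < δ ∧ (C + L) * η ≤ ε := by
      refine ⟨min (δ / 2) (ε / (C + L + 1)), by positivity, ?_, ?_⟩
      · have := min_le_left (δ / 2) (ε / (C + L + 1)); linarith
      · calc (C + L) * min (δ / 2) (ε / (C + L + 1)) ≤ (C + L + 1) * (ε / (C + L + 1)) := by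
              refine mul_le_mul (by linarith) (min_le_right _ _) (by positivity) (by positivity)
          _ = ε := by field_simp
    obtain ⟨z, hzT, hz⟩ := (infDist_lt_iff ⟨x, hxT⟩).1
      (show infDist y T < infDist y T + η by linarith)
    have h1 : ‖f y - f z‖ ≤ C * ‖y - z‖ := hf z hzT y (mem_ball.2 (hz.trans hη1))
    have h2 : ‖g z - g y‖ ≤ L * ‖y - z‖ := by
      rw [← dist_eq_norm, ← dist_eq_norm, dist_comm y z]
      exact hg.dist_le_mul z y
    have h3 : f y - g y = (f y - f z) + (g z - g y) := by rw [hgf hzT]; abel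
    rw [dist_eq_norm] at hz
    calc ‖f y - g y‖ ≤ ‖f y - f z‖ + ‖g z - g y‖ := by rw [h3]; exact norm_add_le _ _
      _ ≤ (C + L) * ‖y - z‖ := by linarith
      _ ≤ (C + L) * (infDist y T + η) := by gcongr
      _ ≤ (C + L) * infDist y T + ε := by linarith
  have hfg : HasFDerivAt (fun y => f y - g y) (0 : E →L[ℝ] F) x := by
    rw [hasFDerivAt_iff_isLittleO]
    have : (fun y => f y - g y) =O[𝓝 x] fun y => infDist y T := by
      refine Asymptotics.IsBigO.of_bound (C + L) ?_
      filter_upwards [ball_mem_nhds x (half_pos hδ)] with y hy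
      rw [Real.norm_of_nonneg infDist_nonneg]
      exact hbound y hy
    simpa [hgf hxT] using this.trans_isLittleO hdo
  have := hfg.differentiableAt.add hgx
  exact this.congr_of_eventuallyEq (Filter.Eventually.of_forall fun y => by simp)

/-- **Stepanov's theorem**: a map between finite-dimensional spaces is differentiable at almost
every point around which it has linear growth. -/
theorem ae_differentiableAt_of_linear_growth [FiniteDimensional ℝ F]
    [MeasurableSpace E] [BorelSpace E]
    (μ : Measure E) [μ.IsAddHaarMeasure] (f : E → F) :
    ∀ᵐ x ∂μ, (∃ C δ : ℝ, 0 < δ ∧ ∀ y ∈ ball x δ, ‖f y - f x‖ ≤ C * ‖y - x‖) →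
      DifferentiableAt ℝ f x := by
  have key : ∀ N k : ℕ, ∀ᵐ x ∂μ,
      x ∈ {x | ∀ y ∈ ball x (1 / ((N : ℝ) + 1)), ‖f y - f x‖ ≤ N * ‖y - x‖} ∩
        ball (TopologicalSpace.denseSeq E k) (1 / ((N : ℝ) + 1) / 2) →
      DifferentiableAt ℝ f x := by
    intro N k
    refine ae_differentiableAt_of_uniform_linear_growth μ (C := N) (δ := 1 / ((N : ℝ) + 1))
      (by positivity) (by positivity) ?_ fun x hx => hx.1
    intro x hx y hy
    have h1 := mem_ball.1 hx.2
    have h2 := mem_ball'.1 hy.2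
    linarith [dist_triangle x (TopologicalSpace.denseSeq E k) y]
  filter_upwards [ae_all_iff.2 fun N => ae_all_iff.2 (key N)] with x hx
  rintro ⟨C, δ, hδ, h⟩
  obtain ⟨N₁, hN₁⟩ := exists_nat_ge C
  obtain ⟨N₂, hN₂⟩ := exists_nat_one_div_lt hδ
  set N := max N₁ N₂
  have hpos : (0 : ℝ) < 1 / ((N : ℝ) + 1) / 2 := by positivity
  obtain ⟨k, hk⟩ := (TopologicalSpace.denseRange_denseSeq E).exists_dist_lt x hpos
  refine hx N k ⟨fun y hy => ?_, mem_ball.2 hk⟩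
  have hN : 1 / ((N : ℝ) + 1) ≤ 1 / ((N₂ : ℝ) + 1) := by
    gcongr; exact le_max_right _ _
  refine (h y (ball_subset_ball (hN.trans hN₂.le) hy)).trans ?_
  gcongr
  exact hN₁.trans (by exact_mod_cast le_max_left _ _)

end Stepanov

/-! ### Monotonicity of open maps -/

/-- The closed cube with centre `x` and half-side `s`. -/
def cube {n : ℕ} (x : Euc n) (s : ℝ) : Set (Euc n) := {y | ∀ i, |y i - x i| ≤ s}

/-- The boundary of the cube `cube x s`. -/
def cubeBdry {n : ℕ} (x : Euc n) (s : ℝ) : Set (Euc n) :=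
  {y | y ∈ cube x s ∧ ∃ i, |y i - x i| = s}

theorem Euc.norm_le_sum {n : ℕ} (v : Euc n) : ‖v‖ ≤ ∑ i, |v i| := by
  conv_lhs => rw [← (EuclideanSpace.basisFun (Fin n) ℝ).sum_repr v]
  refine (norm_sum_le _ _).trans (Finset.sum_le_sum fun i _ => ?_)
  simp [norm_smul]

theorem Euc.abs_apply_le_norm {n : ℕ} (v : Euc n) (i : Fin n) : |v i| ≤ ‖v‖ :=
  PiLp.norm_apply_le v i

theorem cube_subset_closedBall {n : ℕ} (x : Euc n) (s : ℝ) :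
    cube x s ⊆ closedBall x (n * s) := by
  intro y hy
  rw [mem_closedBall, dist_eq_norm]
  refine (Euc.norm_le_sum _).trans ?_
  calc ∑ i, |(y - x) i| ≤ ∑ _i : Fin n, s := Finset.sum_le_sum fun i _ => hy i
    _ = n * s := by simp

theorem isClosed_cube {n : ℕ} (x : Euc n) (s : ℝ) : IsClosed (cube x s) := by
  simp only [cube, ofPred_forall]
  exact isClosed_iInter fun i => isClosed_le (by fun_prop) continuous_const

theorem isCompact_cube {n : ℕ} (x : Euc n) (s : ℝ) : IsCompact (cube x s) :=
  (isCompact_closedBall x (n * s)).of_isClosed_subset (isClosed_cube x s)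
    (cube_subset_closedBall x s)

/-- A linear functional of a continuous map which is open on a cube attains its maximum over the
cube on the boundary. -/
theorem exists_cubeBdry_ge {n : ℕ} {f : Euc n → Euc n} {x : Euc n} {s : ℝ}
    (hf : ContinuousOn f (cube x s))
    (hopen : ∀ U : Set (Euc n), IsOpen U → U ⊆ cube x s → IsOpen (f '' U))
    (ℓ : Euc n →L[ℝ] ℝ) (v : Euc n) (hv : 0 < ℓ v) {p : Euc n} (hp : p ∈ cube x s) :
    ∃ q ∈ cubeBdry x s, ℓ (f p) ≤ ℓ (f q) := by
  obtain ⟨q, hq, hmax⟩ := (isCompact_cube x s).exists_isMaxOn ⟨p, hp⟩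
    (ℓ.continuous.comp_continuousOn hf)
  refine ⟨q, ⟨hq, ?_⟩, hmax hp⟩
  by_contra! hne
  set U : Set (Euc n) := {y | ∀ i, |y i - x i| < s}
  have hU : IsOpen U := by
    simp only [U, ofPred_forall]
    exact isOpen_iInter_of_finite fun i => isOpen_lt (by fun_prop) continuous_const
  have hUc : U ⊆ cube x s := fun y hy i => (hy i).le
  have hqU : q ∈ U := fun i => lt_of_le_of_ne (hq i) (hne i)
  have hnhds : f '' U ∈ 𝓝 (f q) := (hopen U hU hUc).mem_nhds ⟨q, hqU, rfl⟩
  have htend : Filter.Tendsto (fun t : ℝ => f q + t • v) (𝓝[>] 0) (𝓝 (f q)) := by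
    have : Continuous fun t : ℝ => f q + t • v := by fun_prop
    simpa using (this.tendsto 0).mono_left nhdsWithin_le_nhds
  obtain ⟨t, ⟨y, hy, hyt⟩, ht⟩ :=
    ((htend.eventually hnhds).and self_mem_nhdsWithin).exists
  have h1 : ℓ (f y) ≤ ℓ (f q) := hmax (hUc hy)
  have h2 : 0 < t * ℓ v := mul_pos ht hv
  rw [hyt, map_add, map_smul, smul_eq_mul] at h1
  linarith

/-- The oscillation of a continuous open map on a cube is controlled by its oscillation on the
boundary. -/
theorem norm_sub_le_of_cubeBdry {n : ℕ} {f : Euc n → Euc n} {x : Euc n} {s M : ℝ}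
    (hf : ContinuousOn f (cube x s))
    (hopen : ∀ U : Set (Euc n), IsOpen U → U ⊆ cube x s → IsOpen (f '' U))
    (hM : ∀ p ∈ cubeBdry x s, ∀ q ∈ cubeBdry x s, ‖f p - f q‖ ≤ M)
    {p q : Euc n} (hp : p ∈ cube x s) (hq : q ∈ cube x s) : ‖f p - f q‖ ≤ n * M := by
  have key : ∀ i, ∀ p ∈ cube x s, ∀ q ∈ cube x s, f p i - f q i ≤ M := by
    intro i p hp q hq
    let ℓ : Euc n →L[ℝ] ℝ := EuclideanSpace.proj i
    have hℓ : ∀ v, ℓ v = v i := fun v => rfl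
    obtain ⟨p', hp', hpp⟩ := exists_cubeBdry_ge hf hopen ℓ (EuclideanSpace.single i 1)
      (by simp [hℓ]) hp
    obtain ⟨q', hq', hqq⟩ := exists_cubeBdry_ge hf hopen (-ℓ) (-EuclideanSpace.single i 1)
      (by simp [hℓ]) hq
    simp only [neg_apply, hℓ] at hpp hqq
    have h1 := (Euc.abs_apply_le_norm (f p' - f q') i).trans (hM p' hp' q' hq')
    have h2 := le_abs_self ((f p' - f q') i)
    simp only [PiLp.sub_apply] at h1 h2
    linarith
  refine (Euc.norm_le_sum _).trans ?_
  calc ∑ i, |(f p - f q) i| ≤ ∑ _i : Fin n, M := by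
        refine Finset.sum_le_sum fun i _ => abs_le.2 ⟨?_, key i p hp q hq⟩
        have := key i q hq p hp
        simp only [PiLp.sub_apply]
        linarith
    _ = n * M := by simp

/-! ### An oscillation estimate on a cube -/

theorem lintegral_Ioc_le_rpow {k : ℕ} (hk : 2 ≤ k) {I : ℝ → ℝ≥0∞} {V H : ℝ≥0∞}
    (hI : ∀ t ∈ Ioc (0 : ℝ) 1, I t ≤ V)
    (hI' : ∀ t ∈ Ioc (0 : ℝ) 1, ENNReal.ofReal t ^ k * I t ≤ H) :
    ∫⁻ t in Ioc (0 : ℝ) 1, I t ≤ (V + 1) * H ^ (1 / (k : ℝ)) := by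
  have hk0 : (0 : ℝ) < k := by positivity
  have hk2 : (2 : ℝ) ≤ k := by exact_mod_cast hk
  have hpos : ∀ t ∈ Ioc (0 : ℝ) 1, ENNReal.ofReal t ^ k ≠ 0 := fun t ht => by
    simp [ht.1]
  rcases eq_or_ne H 0 with rfl | hH0
  · have : ∫⁻ t in Ioc (0 : ℝ) 1, I t = 0 := by
      refine setLIntegral_eq_zero measurableSet_Ioc fun t ht => ?_
      have := hI' t ht
      simpa [hpos t ht] using this
    simp [this]
  rcases eq_or_ne H ⊤ with rfl | hHt
  · rw [ENNReal.top_rpow_of_pos (by positivity), ENNReal.mul_top (by simp)]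
    exact le_top
  set h : ℝ := H.toReal with hh
  have hpos' : 0 < h := ENNReal.toReal_pos hH0 hHt
  have hH : H = ENNReal.ofReal h := (ENNReal.ofReal_toReal hHt).symm
  set c : ℝ := h ^ (1 / (k : ℝ)) with hc
  have hc0 : 0 < c := Real.rpow_pos_of_pos hpos' _
  have hHc : H ^ (1 / (k : ℝ)) = ENNReal.ofReal c := by
    rw [hH, ENNReal.ofReal_rpow_of_pos hpos']
  have hck : c ^ (k : ℝ) = h := by
    rw [hc, ← Real.rpow_mul hpos'.le, one_div_mul_cancel hk0.ne', Real.rpow_one]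
  set J : ℝ → ℝ≥0∞ := (Ioc (0 : ℝ) 1).indicator I with hJ
  have hJ1 : ∀ t ∈ Ioc (0 : ℝ) c, J t ≤ V := fun t _ => by
    by_cases ht : t ∈ Ioc (0 : ℝ) 1
    · rw [hJ, indicator_of_mem ht]; exact hI t ht
    · rw [hJ, indicator_of_notMem ht]; exact zero_le
  have hJ2 : ∀ t ∈ Ioi c, J t ≤ ENNReal.ofReal (h * t ^ (-(k : ℝ))) := fun t htc => by
    by_cases ht : t ∈ Ioc (0 : ℝ) 1
    · rw [hJ, indicator_of_mem ht, ENNReal.ofReal_mul hpos'.le, ← hH, Real.rpow_neg ht.1.le,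
        ENNReal.ofReal_inv_of_pos (Real.rpow_pos_of_pos ht.1 _), Real.rpow_natCast,
        ENNReal.ofReal_pow ht.1.le, ← div_eq_mul_inv,
        ENNReal.le_div_iff_mul_le (Or.inl (hpos t ht)) (Or.inl (by simp)), mul_comm]
      exact hI' t ht
    · rw [hJ, indicator_of_notMem ht]; exact zero_le
  have hint : IntegrableOn (fun t : ℝ => h * t ^ (-(k : ℝ))) (Ioi c) :=
    (integrableOn_Ioi_rpow_of_lt (by linarith) hc0).const_mul h
  calc ∫⁻ t in Ioc (0 : ℝ) 1, I t = ∫⁻ t in Ioc (0 : ℝ) 1, J t :=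
        setLIntegral_congr_fun measurableSet_Ioc fun t ht => by
          rw [hJ, indicator_of_mem ht]
    _ ≤ ∫⁻ t in Ioc (0 : ℝ) c ∪ Ioi c, J t := by
        refine lintegral_mono_set fun t ht => ?_
        rcases le_or_gt t c with h | h
        · exact Or.inl ⟨ht.1, h⟩
        · exact Or.inr h
    _ ≤ (∫⁻ t in Ioc (0 : ℝ) c, J t) + ∫⁻ t in Ioi c, J t := lintegral_union_le _ _ _
    _ ≤ (∫⁻ _t in Ioc (0 : ℝ) c, V) + ∫⁻ t in Ioi c, ENNReal.ofReal (h * t ^ (-(k : ℝ))) :=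
        add_le_add (setLIntegral_mono' measurableSet_Ioc hJ1)
          (setLIntegral_mono' measurableSet_Ioi hJ2)
    _ = V * ENNReal.ofReal c + ENNReal.ofReal (∫ t in Ioi c, h * t ^ (-(k : ℝ))) := by
        rw [setLIntegral_const, Real.volume_Ioc, sub_zero,
          ofReal_integral_eq_lintegral_ofReal hint]
        filter_upwards [self_mem_ae_restrict measurableSet_Ioi] with t ht
        exact mul_nonneg hpos'.le (Real.rpow_nonneg (hc0.trans ht).le _)
    _ ≤ V * ENNReal.ofReal c + ENNReal.ofReal c := by
        gcongr
        rw [integral_const_mul, integral_Ioi_rpow_of_lt (by linarith) hc0,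
          Real.rpow_add hc0, Real.rpow_neg hc0.le, hck, Real.rpow_one]
        have h1 : h * (-(h⁻¹ * c) / (-(k : ℝ) + 1)) = c / (k - 1) := by
          have : (k : ℝ) - 1 ≠ 0 := by linarith
          have h' : -(k : ℝ) + 1 ≠ 0 := by linarith
          field_simp
          ring
        rw [h1]
        exact div_le_self hc0.le (by linarith)
    _ = (V + 1) * H ^ (1 / (k : ℝ)) := by rw [hHc]; ring

theorem lintegral_comp_homothety {k : ℕ} {F : (Fin k → ℝ) → ℝ≥0∞} (hF : Measurable F)
    (x : Fin k → ℝ) {t : ℝ} (ht : 0 < t) :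
    ENNReal.ofReal t ^ k * ∫⁻ y, F (x + t • (y - x)) = ∫⁻ y, F y := by
  have h1 : ∫⁻ y, F (x + t • (y - x)) =
      ∫⁻ y, F (y + (x - t • x)) ∂(Measure.map (fun y => t • y) volume) := by
    rw [lintegral_map (by fun_prop) (by fun_prop)]
    congr 1 with y
    congr 1
    rw [smul_sub]; abel
  rw [h1, Measure.map_addHaar_smul _ ht.ne', lintegral_smul_measure, lintegral_add_right_eq_self,
    Module.finrank_fin_fun, abs_of_pos (by positivity), ENNReal.ofReal_inv_of_pos (by positivity),
    ENNReal.ofReal_pow ht.le, smul_eq_mul, ← mul_assoc, ENNReal.mul_inv_cancel, one_mul]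
  · simp [ht]
  · simp

/-- The cube `[-1, 1]^k`. -/
def stdCube (k : ℕ) : Set (Fin k → ℝ) := Icc (fun _ => -1) (fun _ => 1)

theorem measurableSet_stdCube (k : ℕ) : MeasurableSet (stdCube k) := measurableSet_Icc

theorem convex_stdCube (k : ℕ) : Convex ℝ (stdCube k) := convex_Icc _ _

theorem volume_stdCube (k : ℕ) : volume (stdCube k) = 2 ^ k := by
  rw [stdCube, Real.volume_Icc_pi]
  norm_num

theorem homothety_mem_stdCube {k : ℕ} {x y : Fin k → ℝ} (hx : x ∈ stdCube k)
    (hy : y ∈ stdCube k) {t : ℝ} (ht : t ∈ Ioc (0 : ℝ) 1) : x + t • (y - x) ∈ stdCube k :=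
  (convex_stdCube k).add_smul_sub_mem hx hy ⟨ht.1.le, ht.2⟩

theorem lintegral_segments_le {k : ℕ} (hk : 2 ≤ k) {h : (Fin k → ℝ) → ℝ≥0∞} (hm : Measurable h)
    (h1 : ∀ y, h y ≤ 1) {x : Fin k → ℝ} (hx : x ∈ stdCube k) :
    ∫⁻ y in stdCube k, ∫⁻ t in Ioc (0 : ℝ) 1, h (x + t • (y - x)) ≤
      (2 ^ k + 1) * (∫⁻ y in stdCube k, h y) ^ (1 / (k : ℝ)) := by
  rw [lintegral_lintegral_swap (by fun_prop)]
  refine lintegral_Ioc_le_rpow hk (fun t _ => ?_) fun t ht => ?_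
  · calc ∫⁻ y in stdCube k, h (x + t • (y - x)) ≤ ∫⁻ _y in stdCube k, 1 :=
          lintegral_mono fun y => h1 _
      _ = 2 ^ k := by rw [setLIntegral_const, volume_stdCube, one_mul]
  · rw [← lintegral_indicator (measurableSet_stdCube k) h,
      ← lintegral_comp_homothety (hm.indicator (measurableSet_stdCube k)) x ht.1,
      ← lintegral_indicator (measurableSet_stdCube k)]
    gcongr with y
    by_cases hy : y ∈ stdCube k
    · rw [indicator_of_mem hy, indicator_of_mem (homothety_mem_stdCube hx hy ht)]
    · simp [indicator_of_notMem hy]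

/-- Oscillation estimate on `[-1, 1]^k` for a map whose increments are bounded by integrals over
segments of a function `L * (b + ∑ a j * h j)` with `0 ≤ h j ≤ 1`. -/
theorem edist_le_of_segments {k : ℕ} (hk : 2 ≤ k) {E : Type*} [PseudoEMetricSpace E]
    {u : (Fin k → ℝ) → E} {L b : ℝ≥0∞} {a : ℕ → ℝ≥0∞} {h : ℕ → (Fin k → ℝ) → ℝ≥0∞}
    (hm : ∀ j, Measurable (h j)) (h1 : ∀ j y, h j y ≤ 1)
    (hu : ∀ x ∈ stdCube k, ∀ y ∈ stdCube k, edist (u x) (u y) ≤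
      L * ∫⁻ t in Ioc (0 : ℝ) 1, (b + ∑' j, a j * h j (x + t • (y - x))))
    {x x' : Fin k → ℝ} (hx : x ∈ stdCube k) (hx' : x' ∈ stdCube k) :
    edist (u x) (u x') ≤
      2 * L * (b + 2 * ∑' j, a j * (∫⁻ y in stdCube k, h j y) ^ (1 / (k : ℝ))) := by
  set Ψ : (Fin k → ℝ) → (Fin k → ℝ) → ℝ≥0∞ := fun x y =>
    L * ∫⁻ t in Ioc (0 : ℝ) 1, (b + ∑' j, a j * h j (x + t • (y - x))) with hΨ
  set S : ℝ≥0∞ := ∑' j, a j * (∫⁻ y in stdCube k, h j y) ^ (1 / (k : ℝ)) with hS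
  have hmeas : ∀ x, Measurable (Ψ x) := fun x => by
    refine Measurable.const_mul (Measurable.lintegral_prod_right' (f := fun p : (Fin k → ℝ) × ℝ =>
      b + ∑' j, a j * h j (x + p.2 • (p.1 - x))) ?_) _
    fun_prop
  have hbound : ∀ x ∈ stdCube k, ∫⁻ y in stdCube k, Ψ x y ≤ L * (2 ^ k * (b + 2 * S)) := by
    intro x hx
    have hinner : ∀ y, ∫⁻ t in Ioc (0 : ℝ) 1, (b + ∑' j, a j * h j (x + t • (y - x))) =
        b + ∑' j, a j * ∫⁻ t in Ioc (0 : ℝ) 1, h j (x + t • (y - x)) := by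
      intro y
      rw [lintegral_add_left measurable_const, setLIntegral_const, Real.volume_Ioc, sub_zero,
        ENNReal.ofReal_one, mul_one, lintegral_tsum fun j => by fun_prop]
      congr 2 with j
      rw [lintegral_const_mul _ (by fun_prop)]
    have hmj : ∀ j, Measurable fun y => ∫⁻ t in Ioc (0 : ℝ) 1, h j (x + t • (y - x)) := fun j =>
      Measurable.lintegral_prod_right' (f := fun p : (Fin k → ℝ) × ℝ =>
        h j (x + p.2 • (p.1 - x))) (by fun_prop)
    simp only [hΨ, hinner]
    rw [lintegral_const_mul _ (by fun_prop), lintegral_add_left measurable_const,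
      setLIntegral_const, volume_stdCube, lintegral_tsum fun j => by fun_prop]
    gcongr L * ?_
    calc b * 2 ^ k + ∑' j, ∫⁻ y in stdCube k, a j * ∫⁻ t in Ioc (0 : ℝ) 1, h j (x + t • (y - x))
        ≤ b * 2 ^ k + ∑' j, a j * ((2 ^ k + 1) *
            (∫⁻ y in stdCube k, h j y) ^ (1 / (k : ℝ))) := by
          gcongr with j
          rw [lintegral_const_mul _ (hmj j)]
          gcongr
          exact lintegral_segments_le hk (hm j) (h1 j) hx
      _ = b * 2 ^ k + (2 ^ k + 1) * S := by
          rw [hS, ← ENNReal.tsum_mul_left]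
          congr 2 with j
          ring
      _ ≤ b * 2 ^ k + (2 ^ k + 2 ^ k) * S := by
          gcongr
          exact one_le_pow₀ (by norm_num)
      _ = 2 ^ k * (b + 2 * S) := by ring
  have hmain : 2 ^ k * edist (u x) (u x') ≤ 2 ^ k * (2 * L * (b + 2 * S)) := by
    calc 2 ^ k * edist (u x) (u x') = ∫⁻ _y in stdCube k, edist (u x) (u x') := by
          rw [setLIntegral_const, volume_stdCube, mul_comm]
      _ ≤ ∫⁻ y in stdCube k, (Ψ x y + Ψ x' y) := by
          refine setLIntegral_mono' (measurableSet_stdCube k) fun y hy => ?_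
          refine (edist_triangle_right _ _ (u y)).trans (add_le_add (hu x hx y hy) (hu x' hx' y hy))
      _ = (∫⁻ y in stdCube k, Ψ x y) + ∫⁻ y in stdCube k, Ψ x' y := lintegral_add_left (hmeas x) _
      _ ≤ L * (2 ^ k * (b + 2 * S)) + L * (2 ^ k * (b + 2 * S)) :=
          add_le_add (hbound x hx) (hbound x' hx')
      _ = 2 ^ k * (2 * L * (b + 2 * S)) := by ring
  rwa [ENNReal.mul_le_mul_iff_right (by simp) (by simp)] at hmain

/-! ### The Calderón condition in dyadic form -/

theorem tsum_calderon_lt_top {k : ℕ} (hk : 2 ≤ k) {φ : ℝ → ℝ} (hφ : MonotoneOn φ (Ici 0))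
    (hC : CalderonCondition (k + 1) φ) :
    ∑' j : ℕ, (2 : ℝ≥0∞) ^ j *
      (2 ^ j / ENNReal.ofReal (φ (2 ^ (j + 1)))) ^ (1 / ((k : ℝ) - 1)) < ⊤ := by
  have hk1 : (0 : ℝ) ≤ 1 / ((k : ℝ) - 1) := by
    have : (2 : ℝ) ≤ k := by exact_mod_cast hk
    exact one_div_nonneg.2 (by linarith)
  have hexp : (((k + 1 : ℕ) : ℝ) - 2) = (k : ℝ) - 1 := by push_cast; ring
  rw [CalderonCondition, hexp] at hC
  refine lt_of_le_of_lt ?_ hC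
  have hmono : Monotone fun j : ℕ => (2 : ℝ) ^ j := fun i j h =>
    pow_le_pow_right₀ (by norm_num) h
  have hdisj := hmono.pairwise_disjoint_on_Ioc_succ
  calc ∑' j : ℕ, (2 : ℝ≥0∞) ^ j *
        (2 ^ j / ENNReal.ofReal (φ (2 ^ (j + 1)))) ^ (1 / ((k : ℝ) - 1))
      ≤ ∑' j : ℕ, ∫⁻ t in Ioc ((2 : ℝ) ^ j) (2 ^ (Order.succ j)),
          (ENNReal.ofReal t / ENNReal.ofReal (φ t)) ^ (1 / ((k : ℝ) - 1)) := by
        gcongr with j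
        have hvol : volume (Ioc ((2 : ℝ) ^ j) (2 ^ (Order.succ j))) = 2 ^ j := by
          rw [Real.volume_Ioc, Order.succ_eq_add_one,
            show (2 : ℝ) ^ (j + 1) - 2 ^ j = 2 ^ j by ring, ENNReal.ofReal_pow (by norm_num)]
          norm_num
        rw [mul_comm, ← hvol, ← setLIntegral_const, hvol]
        refine setLIntegral_mono' measurableSet_Ioc fun t ht => ?_
        have h0 : (0 : ℝ) < 2 ^ j := by positivity
        have h2 : (2 : ℝ≥0∞) ^ j ≤ ENNReal.ofReal t := by
          rw [show (2 : ℝ≥0∞) ^ j = ENNReal.ofReal (2 ^ j) by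
            rw [ENNReal.ofReal_pow (by norm_num)]; norm_num]
          exact ENNReal.ofReal_le_ofReal ht.1.le
        gcongr
        exact hφ (h0.trans ht.1).le (by simp) ht.2
    _ = ∫⁻ t in ⋃ j : ℕ, Ioc ((2 : ℝ) ^ j) (2 ^ (Order.succ j)),
          (ENNReal.ofReal t / ENNReal.ofReal (φ t)) ^ (1 / ((k : ℝ) - 1)) :=
        (lintegral_iUnion (fun j => measurableSet_Ioc) hdisj _).symm
    _ ≤ _ := by
        refine lintegral_mono_set (iUnion_subset fun j t ht => ?_)
        exact lt_of_le_of_lt (one_le_pow₀ (by norm_num)) ht.1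

theorem ENNReal.tsum_mul_le_Lp_mul_Lq {p q : ℝ} (hpq : p.HolderConjugate q) (f g : ℕ → ℝ≥0∞) :
    ∑' j, f j * g j ≤ (∑' j, f j ^ p) ^ (1 / p) * (∑' j, g j ^ q) ^ (1 / q) := by
  simpa [lintegral_count] using ENNReal.lintegral_mul_le_Lp_mul_Lq Measure.count hpq
    (f := f) (g := g) (measurable_of_countable f).aemeasurable
    (measurable_of_countable g).aemeasurable

theorem exists_calderon_constant {k : ℕ} (hk : 2 ≤ k) {φ : ℝ → ℝ} (hφ : MonotoneOn φ (Ici 0))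
    (hC : CalderonCondition (k + 1) φ) :
    ∃ A : ℝ≥0∞, A ≠ ⊤ ∧ ∀ H : ℕ → ℝ≥0∞,
      ∑' j, 2 ^ (j + 2) * H j ^ (1 / (k : ℝ)) ≤
        A * (∑' j, ENNReal.ofReal (φ (2 ^ (j + 1))) * H j) ^ (1 / (k : ℝ)) := by
  have hk2 : (2 : ℝ) ≤ k := by exact_mod_cast hk
  have hk0 : (0 : ℝ) < k := by linarith
  set r : ℝ := 1 / ((k : ℝ) - 1) with hr
  have hr0 : 0 < r := one_div_pos.2 (by linarith)
  have hpq : (1 + r).HolderConjugate k := by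
    refine (Real.holderConjugate_iff.2 ⟨by linarith, ?_⟩)
    rw [hr]
    have : (k : ℝ) - 1 ≠ 0 := by linarith
    have h1 : 1 + 1 / ((k : ℝ) - 1) = k / (k - 1) := by field_simp; ring
    rw [h1, inv_div]
    field_simp
    ring
  set c : ℕ → ℝ≥0∞ := fun j => ENNReal.ofReal (φ (2 ^ (j + 1))) with hc
  have hsum := tsum_calderon_lt_top hk hφ hC
  have hct : ∀ j, c j ≠ ⊤ := fun j => ENNReal.ofReal_ne_top
  have hc0 : ∀ j, c j ≠ 0 := fun j hj => by
    have h1 := ENNReal.ne_top_of_tsum_ne_top hsum.ne j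
    refine h1 ?_
    change 2 ^ j * (2 ^ j / c j) ^ r = ⊤
    rw [hj, ENNReal.div_zero (by simp), ENNReal.top_rpow_of_pos hr0, ENNReal.mul_top (by simp)]
  set B : ℕ → ℝ≥0∞ := fun j => 2 ^ (j + 2) * (c j)⁻¹ ^ (1 / (k : ℝ)) with hB
  have hBp : ∀ j, B j ^ (1 + r) = 4 ^ (1 + r) * (2 ^ j * (2 ^ j / c j) ^ r) := fun j => by
    have hexp : 1 / (k : ℝ) * (1 + r) = r := by
      rw [hr]
      have : (k : ℝ) - 1 ≠ 0 := by linarith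
      field_simp
      ring
    simp only [hB]
    rw [show (2 : ℝ≥0∞) ^ (j + 2) = 4 * 2 ^ j by rw [pow_add]; norm_num [mul_comm],
      ENNReal.mul_rpow_of_nonneg _ _ (by linarith), ← ENNReal.rpow_mul, hexp,
      ENNReal.mul_rpow_of_nonneg _ _ (by linarith), div_eq_mul_inv,
      ENNReal.mul_rpow_of_nonneg _ _ hr0.le,
      ENNReal.rpow_add 1 r (x := 2 ^ j) (by simp) (by simp), ENNReal.rpow_one]
    ring
  refine ⟨(∑' j, B j ^ (1 + r)) ^ (1 / (1 + r)), ?_, fun H => ?_⟩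
  · refine ENNReal.rpow_ne_top_of_nonneg (by positivity) ?_
    simp only [hBp]
    rw [ENNReal.tsum_mul_left]
    exact ENNReal.mul_ne_top (ENNReal.rpow_ne_top_of_nonneg (by positivity) (by simp)) hsum.ne
  · have h1 : ∀ j, 2 ^ (j + 2) * H j ^ (1 / (k : ℝ)) = B j * (c j * H j) ^ (1 / (k : ℝ)) := by
      intro j
      simp only [hB]
      rw [ENNReal.mul_rpow_of_nonneg _ _ (by positivity), mul_assoc,
        ← mul_assoc ((c j)⁻¹ ^ (1 / (k : ℝ))), ← ENNReal.mul_rpow_of_nonneg _ _ (by positivity),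
        ENNReal.inv_mul_cancel (hc0 j) (hct j), ENNReal.one_rpow, one_mul]
    have h2 : ∀ j, ((c j * H j) ^ (1 / (k : ℝ))) ^ (k : ℝ) = c j * H j := fun j => by
      rw [← ENNReal.rpow_mul, one_div_mul_cancel hk0.ne', ENNReal.rpow_one]
    simp only [h1]
    refine (ENNReal.tsum_mul_le_Lp_mul_Lq hpq _ _).trans ?_
    simp only [h2]
    exact le_rfl

/-! ### Faces of cubes -/

/-- The point whose displacement from `x` has `i`-th coordinate `τ` and other coordinates `v`. -/
def facePoint {k : ℕ} (x : Euc (k + 1)) (i : Fin (k + 1)) (τ : ℝ) (v : Fin k → ℝ) :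
    Euc (k + 1) :=
  x + WithLp.toLp 2 (i.insertNth τ v : Fin (k + 1) → ℝ)

/-- The face of `cube x s` on which the `i`-th coordinate of the displacement is `s * σ`. -/
def cubeFace {n : ℕ} (x : Euc n) (s : ℝ) (i : Fin n) (σ : ℝ) : Set (Euc n) :=
  {y | y ∈ cube x s ∧ y i - x i = s * σ}

section Faces

variable {k : ℕ} (x : Euc (k + 1)) (i : Fin (k + 1))

theorem continuous_facePoint :
    Continuous fun p : ℝ × (Fin k → ℝ) => facePoint x i p.1 p.2 := by
  unfold facePoint
  refine continuous_const.add ((PiLp.continuous_toLp 2 _).comp ?_)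
  exact Continuous.finInsertNth i continuous_fst continuous_snd

theorem measurable_facePoint :
    Measurable fun p : ℝ × (Fin k → ℝ) => facePoint x i p.1 p.2 :=
  (continuous_facePoint x i).measurable

theorem facePoint_apply_self (τ : ℝ) (v : Fin k → ℝ) : facePoint x i τ v i - x i = τ := by
  simp [facePoint]

theorem facePoint_apply_succAbove (τ : ℝ) (v : Fin k → ℝ) (j : Fin k) :
    facePoint x i τ v (i.succAbove j) - x (i.succAbove j) = v j := by
  simp [facePoint]

theorem facePoint_mem_cube_iff {τ s : ℝ} {v : Fin k → ℝ} :
    facePoint x i τ v ∈ cube x s ↔ |τ| ≤ s ∧ ∀ j, |v j| ≤ s := by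
  change (∀ l, |facePoint x i τ v l - x l| ≤ s) ↔ _
  rw [Fin.forall_iff_succAbove i]
  simp only [facePoint_apply_self, facePoint_apply_succAbove]

theorem facePoint_eq_self (y : Euc (k + 1)) :
    facePoint x i (y i - x i) (fun j => y (i.succAbove j) - x (i.succAbove j)) = y := by
  have h : ∀ l, facePoint x i (y i - x i) (fun j => y (i.succAbove j) - x (i.succAbove j)) l
      - x l = y l - x l := by
    rw [Fin.forall_iff_succAbove i]
    simp only [facePoint_apply_self, facePoint_apply_succAbove, implies_true, and_self]
  ext l
  linarith [h l]

theorem facePoint_add_smul_sub (τ t : ℝ) (v w : Fin k → ℝ) :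
    facePoint x i τ (v + t • (w - v)) =
      facePoint x i τ v + t • (facePoint x i τ w - facePoint x i τ v) := by
  have h : ∀ l, facePoint x i τ (v + t • (w - v)) l - x l = (facePoint x i τ v l - x l) +
      t * ((facePoint x i τ w l - x l) - (facePoint x i τ v l - x l)) := by
    rw [Fin.forall_iff_succAbove i]
    simp [facePoint_apply_self, facePoint_apply_succAbove]
  ext l
  simp only [PiLp.add_apply, PiLp.smul_apply, PiLp.sub_apply, smul_eq_mul]
  linarith [h l]

theorem norm_facePoint_sub_le (τ : ℝ) {s : ℝ} (hs : 0 ≤ s) {v w : Fin k → ℝ}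
    (hv : v ∈ stdCube k) (hw : w ∈ stdCube k) :
    ‖facePoint x i τ (s • v) - facePoint x i τ (s • w)‖ ≤ 2 * k * s := by
  refine (Euc.norm_le_sum _).trans ?_
  have h0 : (facePoint x i τ (s • v) - facePoint x i τ (s • w)) i = 0 := by
    simp [facePoint]
  have h1 : ∀ j, |(facePoint x i τ (s • v) - facePoint x i τ (s • w)) (i.succAbove j)| ≤
      2 * s := fun j => by
    have : (facePoint x i τ (s • v) - facePoint x i τ (s • w)) (i.succAbove j) =
        s * (v j - w j) := by
      simp [facePoint]; ring
    rw [this, abs_mul, abs_of_nonneg hs, mul_comm]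
    have h1 := hv.1 j
    have h2 := hv.2 j
    have h3 := hw.1 j
    have h4 := hw.2 j
    gcongr
    exact abs_le.2 ⟨by linarith, by linarith⟩
  rw [Fin.sum_univ_succAbove _ i, h0, abs_zero, zero_add]
  calc _ ≤ ∑ _j : Fin k, 2 * s := Finset.sum_le_sum fun j _ => h1 j
    _ = 2 * k * s := by simp; ring

variable {x i} in
theorem exists_facePoint_eq {s σ : ℝ} (hs : 0 < s) {y : Euc (k + 1)}
    (hy : y ∈ cubeFace x s i σ) : ∃ w ∈ stdCube k, facePoint x i (s * σ) (s • w) = y := by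
  refine ⟨s⁻¹ • fun j => y (i.succAbove j) - x (i.succAbove j), ⟨fun j => ?_, fun j => ?_⟩, ?_⟩
  · have := neg_le_of_abs_le (hy.1 (i.succAbove j))
    simp only [Pi.smul_apply, smul_eq_mul, inv_mul_eq_div]
    rw [le_div_iff₀ hs]; linarith
  · have := le_of_abs_le (hy.1 (i.succAbove j))
    simp only [Pi.smul_apply, smul_eq_mul, inv_mul_eq_div]
    rw [div_le_one hs]; linarith
  · rw [smul_smul, mul_inv_cancel₀ hs.ne', one_smul, ← hy.2, facePoint_eq_self]

theorem lintegral_facePoint {Γ : Euc (k + 1) → ℝ≥0∞} (hΓ : Measurable Γ) :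
    ∫⁻ τ : ℝ, ∫⁻ v : Fin k → ℝ, Γ (facePoint x i τ v) = ∫⁻ y, Γ y := by
  have hm : Measurable fun p : ℝ × (Fin k → ℝ) => Γ (facePoint x i p.1 p.2) :=
    hΓ.comp (measurable_facePoint x i)
  rw [← lintegral_add_left_eq_self Γ x, lintegral_lintegral hm.aemeasurable,
    ← (PiLp.volume_preserving_toLp (Fin (k + 1))).lintegral_comp (by fun_prop)]
  have := (volume_preserving_piFinSuccAbove (fun _ : Fin (k + 1) => ℝ) i).lintegral_comp hm
  rw [Measure.volume_eq_prod] at this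
  rw [← this]
  refine lintegral_congr fun y => ?_
  congr 1
  change facePoint x i (y i) (i.removeNth y) = x + WithLp.toLp 2 y
  rw [facePoint, Fin.insertNth_self_removeNth]

theorem lintegral_faces_le {Γ : Euc (k + 1) → ℝ≥0∞} (hΓ : Measurable Γ) {r : ℝ} (hr : 0 < r)
    {σ : ℝ} (hσ : |σ| = 1) :
    ENNReal.ofReal r ^ k * ∫⁻ s in Ioc r (2 * r), ∫⁻ w in stdCube k,
      Γ (facePoint x i (s * σ) (s • w)) ≤ ∫⁻ y in cube x (2 * r), Γ y := by
  have hcm : MeasurableSet (cube x (2 * r)) := (isClosed_cube _ _).measurableSet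
  set Γ' := (cube x (2 * r)).indicator Γ with hΓ'
  have hΓ'm : Measurable Γ' := hΓ.indicator hcm
  set N : ℝ → ℝ≥0∞ := fun τ => ∫⁻ v : Fin k → ℝ, Γ' (facePoint x i τ v) with hN
  have hNm : Measurable N := Measurable.lintegral_prod_right'
    (f := fun p : ℝ × (Fin k → ℝ) => Γ' (facePoint x i p.1 p.2))
    (hΓ'm.comp (measurable_facePoint x i))
  have hNσ : ∫⁻ s, N (s * σ) = ∫⁻ τ, N τ := by
    rcases eq_or_eq_neg_of_abs_eq hσ with rfl | rfl
    · simp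
    · simpa using lintegral_neg_eq_self N
  have hslice : ∀ s ∈ Ioc r (2 * r), ENNReal.ofReal r ^ k * ∫⁻ w in stdCube k,
      Γ (facePoint x i (s * σ) (s • w)) ≤ N (s * σ) := by
    intro s hs
    have hs0 : 0 < s := hr.trans hs.1
    have hmΓ : Measurable fun v : Fin k → ℝ => Γ' (facePoint x i (s * σ) v) :=
      hΓ'm.comp ((measurable_facePoint x i).comp (by fun_prop : Measurable (fun v => (s * σ, v))))
    rw [hN]
    simp only
    rw [← lintegral_comp_homothety hmΓ 0 hs0]
    gcongr ?_ ^ k * ?_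
    · exact ENNReal.ofReal_le_ofReal hs.1.le
    · refine (setLIntegral_mono' (measurableSet_stdCube k) fun w hw => ?_).trans
        (setLIntegral_le_lintegral (stdCube k) _)
      rw [zero_add, sub_zero, hΓ', indicator_of_mem]
      rw [facePoint_mem_cube_iff]
      refine ⟨by rw [abs_mul, hσ, abs_of_pos hs0, mul_one]; exact hs.2, fun j => ?_⟩
      have h1 : |w j| ≤ 1 := abs_le.2 ⟨hw.1 j, hw.2 j⟩
      rw [Pi.smul_apply, smul_eq_mul, abs_mul, abs_of_pos hs0]
      exact (mul_le_of_le_one_right hs0.le h1).trans hs.2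
  calc _ ≤ ∫⁻ s in Ioc r (2 * r), ENNReal.ofReal r ^ k * ∫⁻ w in stdCube k,
        Γ (facePoint x i (s * σ) (s • w)) := lintegral_const_mul_le _ _
    _ ≤ ∫⁻ s in Ioc r (2 * r), N (s * σ) := setLIntegral_mono' measurableSet_Ioc hslice
    _ ≤ ∫⁻ s, N (s * σ) := setLIntegral_le_lintegral _ _
    _ = ∫⁻ y in cube x (2 * r), Γ y := by
        rw [hNσ, lintegral_facePoint x i hΓ'm, hΓ', lintegral_indicator hcm]

/-- There is a cube of comparable size over each of whose faces the integral is controlled by the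
integral over the double cube. -/
theorem exists_lintegral_face_le {Γ : Euc (k + 1) → ℝ≥0∞} (hΓ : Measurable Γ) {r : ℝ}
    (hr : 0 < r) :
    ∃ s ∈ Ioc r (2 * r), ∀ i, ∀ σ ∈ ({1, -1} : Finset ℝ),
      ENNReal.ofReal r ^ (k + 1) * ∫⁻ w in stdCube k, Γ (facePoint x i (s * σ) (s • w)) ≤
        2 * (k + 1) * ∫⁻ y in cube x (2 * r), Γ y := by
  set B : ℝ → ℝ≥0∞ := fun s => ∑ q ∈ (Finset.univ : Finset (Fin (k + 1))) ×ˢ ({1, -1} : Finset ℝ),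
    ∫⁻ w in stdCube k, Γ (facePoint x q.1 (s * q.2) (s • w)) with hB
  have hterm : ∀ q : Fin (k + 1) × ℝ, Measurable fun s : ℝ =>
      ∫⁻ w in stdCube k, Γ (facePoint x q.1 (s * q.2) (s • w)) := fun q => by
    refine Measurable.lintegral_prod_right' (f := fun p : ℝ × (Fin k → ℝ) =>
      Γ (facePoint x q.1 (p.1 * q.2) (p.1 • p.2))) ?_
    exact hΓ.comp ((measurable_facePoint x q.1).comp
      (by fun_prop : Measurable fun p : ℝ × (Fin k → ℝ) => (p.1 * q.2, p.1 • p.2)))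
  have hBm : Measurable B := Finset.measurable_fun_sum _ fun q _ => hterm q
  have hvol : volume (Ioc r (2 * r)) = ENNReal.ofReal r := by
    rw [Real.volume_Ioc]; congr 1; ring
  have hr0 : ENNReal.ofReal r ≠ 0 := by simpa using hr
  obtain ⟨s, hs, hsB⟩ := exists_le_setLAverage (μ := volume) (s := Ioc r (2 * r)) (f := B)
    (by rw [hvol]; exact hr0) (by rw [hvol]; simp) hBm.aemeasurable
  have hsum : ENNReal.ofReal r ^ k * ∫⁻ s in Ioc r (2 * r), B s ≤
      2 * (k + 1) * ∫⁻ y in cube x (2 * r), Γ y := by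
    rw [hB, lintegral_finsetSum _ fun q _ => hterm q, Finset.mul_sum]
    refine (Finset.sum_le_card_nsmul _ _ (∫⁻ y in cube x (2 * r), Γ y) fun q hq => ?_).trans ?_
    · refine lintegral_faces_le x q.1 hΓ hr ?_
      have := (Finset.mem_product.1 hq).2
      rw [Finset.mem_insert, Finset.mem_singleton] at this
      rcases this with h | h <;> rw [h] <;> simp
    · rw [nsmul_eq_mul, Finset.card_product, Finset.card_univ, Fintype.card_fin,
        Finset.card_pair (by norm_num)]
      push_cast
      rw [mul_comm ((k : ℝ≥0∞) + 1) 2]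
  refine ⟨s, hs, fun i σ hσ => ?_⟩
  calc ENNReal.ofReal r ^ (k + 1) * ∫⁻ w in stdCube k, Γ (facePoint x i (s * σ) (s • w))
      ≤ ENNReal.ofReal r ^ (k + 1) * B s := by
        gcongr
        exact Finset.single_le_sum
          (f := fun q : Fin (k + 1) × ℝ =>
            ∫⁻ w in stdCube k, Γ (facePoint x q.1 (s * q.2) (s • w)))
          (fun _ _ => zero_le)
          (show (i, σ) ∈ (Finset.univ : Finset (Fin (k + 1))) ×ˢ ({1, -1} : Finset ℝ) from
            Finset.mem_product.2 ⟨Finset.mem_univ i, hσ⟩)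
    _ ≤ ENNReal.ofReal r ^ (k + 1) * ((∫⁻ s in Ioc r (2 * r), B s) / ENNReal.ofReal r) := by
        gcongr
        rwa [setLAverage_eq, hvol] at hsB
    _ = ENNReal.ofReal r ^ k * ∫⁻ s in Ioc r (2 * r), B s := by
        rw [pow_succ, mul_assoc, ENNReal.mul_div_cancel hr0 (by simp)]
    _ ≤ _ := hsum

end Faces

/-- Chaining through the vertices of the cube: bounds for the oscillation on every face give a
bound for the oscillation on the boundary. -/
theorem edist_le_of_cubeFace {n : ℕ} (hn : 2 ≤ n) {E : Type*} [PseudoEMetricSpace E]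
    {u : Euc n → E} {x : Euc n} {s : ℝ} (hs : 0 < s) {M : ℝ≥0∞}
    (hM : ∀ i, ∀ σ ∈ ({1, -1} : Finset ℝ), ∀ p ∈ cubeFace x s i σ, ∀ q ∈ cubeFace x s i σ,
      edist (u p) (u q) ≤ M) {p q : Euc n} (hp : p ∈ cubeBdry x s) (hq : q ∈ cubeBdry x s) :
    edist (u p) (u q) ≤ 4 * M := by
  let vert : (Fin n → ℝ) → Euc n := fun c => x + WithLp.toLp 2 (s • c)
  have hvert : ∀ c : Fin n → ℝ, (∀ i, |c i| ≤ 1) → ∀ i, vert c ∈ cubeFace x s i (c i) := by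
    intro c hc i
    refine ⟨fun l => ?_, by simp [vert]⟩
    have : vert c l - x l = s * c l := by simp [vert]
    rw [this, abs_mul, abs_of_pos hs]
    exact mul_le_of_le_one_right hs.le (hc l)
  set e : ℝ → Euc n := fun σ => vert fun _ => σ
  have hcorner : ∀ p ∈ cubeBdry x s, ∃ σ ∈ ({1, -1} : Finset ℝ), edist (u p) (u (e σ)) ≤ M := by
    rintro p ⟨hp, i, hi⟩
    rcases eq_or_eq_neg_of_abs_eq hi with h | h
    · exact ⟨1, by simp, hM i 1 (by simp) p ⟨hp, by linarith⟩ _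
        (hvert (fun _ => 1) (by simp) i)⟩
    · exact ⟨-1, by simp, hM i (-1) (by simp) p ⟨hp, by linarith⟩ _
        (hvert (fun _ => -1) (by simp) i)⟩
  have hee : edist (u (e 1)) (u (e (-1))) ≤ 2 * M := by
    let i₀ : Fin n := ⟨0, by omega⟩
    let i₁ : Fin n := ⟨1, by omega⟩
    have hne : i₁ ≠ i₀ := by simp [i₀, i₁]
    let c : Fin n → ℝ := Function.update (fun _ => -1) i₀ 1
    have hc0 : c i₀ = 1 := by simp [c]
    have hc1 : c i₁ = -1 := by simp [c, hne]
    have hc : ∀ i, |c i| ≤ 1 := fun i => by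
      by_cases h : i = i₀
      · rw [h, hc0]; simp
      · simp [c, h]
    have h0 := hvert c hc i₀
    have h1 := hvert c hc i₁
    rw [hc0] at h0
    rw [hc1] at h1
    rw [two_mul]
    exact (edist_triangle _ (u (vert c)) _).trans (add_le_add
      (hM i₀ 1 (by simp) _ (hvert (fun _ => 1) (by simp) i₀) _ h0)
      (hM i₁ (-1) (by simp) _ h1 _ (hvert (fun _ => -1) (by simp) i₁)))
  have hσσ : ∀ σ ∈ ({1, -1} : Finset ℝ), ∀ σ' ∈ ({1, -1} : Finset ℝ),
      edist (u (e σ)) (u (e σ')) ≤ 2 * M := by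
    intro σ hσ σ' hσ'
    simp only [Finset.mem_insert, Finset.mem_singleton] at hσ hσ'
    rcases hσ with rfl | rfl <;> rcases hσ' with rfl | rfl
    · simp
    · exact hee
    · rw [edist_comm]; exact hee
    · simp
  obtain ⟨σ, hσ, hpσ⟩ := hcorner p hp
  obtain ⟨σ', hσ', hqσ⟩ := hcorner q hq
  rw [edist_comm] at hqσ
  calc edist (u p) (u q) ≤ edist (u p) (u (e σ)) + edist (u (e σ)) (u (e σ')) +
        edist (u (e σ')) (u q) := edist_triangle4 _ _ _ _
    _ ≤ M + 2 * M + M := add_le_add (add_le_add hpσ (hσσ σ hσ σ' hσ')) hqσ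
    _ = 4 * M := by ring

/-! ### Mollification -/

theorem edist_le_lintegral_segment {E F : Type*} [NormedAddCommGroup E] [NormedSpace ℝ E]
    [NormedAddCommGroup F] [NormedSpace ℝ F] [CompleteSpace F] {u : E → F}
    (hu : ContDiff ℝ 1 u) {S : Set E} (hS : Convex ℝ S) {q : E → ℝ≥0∞}
    (hq : ∀ y ∈ S, ‖fderiv ℝ u y‖ₑ ≤ q y) {a b : E} (ha : a ∈ S) (hb : b ∈ S) :
    edist (u a) (u b) ≤ ‖b - a‖ₑ * ∫⁻ t in Ioc (0 : ℝ) 1, q (a + t • (b - a)) := by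
  have hderiv : ∀ t : ℝ, HasDerivAt (fun t : ℝ => u (a + t • (b - a)))
      (fderiv ℝ u (a + t • (b - a)) (b - a)) t := fun t => by
    have h1 : HasDerivAt (fun t : ℝ => a + t • (b - a)) (b - a) t := by
      simpa using ((hasDerivAt_id t).smul_const (b - a)).const_add a
    exact ((hu.differentiable one_ne_zero) _).hasFDerivAt.comp_hasDerivAt t h1
  have hcont : Continuous fun t : ℝ => fderiv ℝ u (a + t • (b - a)) (b - a) :=
    ((hu.continuous_fderiv one_ne_zero).comp (by fun_prop)).clm_apply continuous_const
  have hint := intervalIntegral.integral_eq_sub_of_hasDerivAt (a := 0) (b := 1)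
    (fun t _ => hderiv t) (hcont.intervalIntegrable _ _)
  rw [intervalIntegral.integral_of_le zero_le_one] at hint
  simp only [one_smul, zero_smul, add_zero, add_sub_cancel] at hint
  rw [edist_comm, edist_eq_enorm_sub, ← hint]
  refine (enorm_integral_le_lintegral_enorm _).trans ?_
  rw [← lintegral_const_mul' _ _ enorm_ne_top]
  refine setLIntegral_mono' measurableSet_Ioc fun t ht => ?_
  have hmem : a + t • (b - a) ∈ S := hS.add_smul_sub_mem ha hb ⟨ht.1.le, ht.2⟩
  rw [mul_comm]
  exact (ContinuousLinearMap.le_opENorm _ _).trans (by gcongr; exact hq _ hmem)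

/-- Smooth approximation of a continuous Sobolev map, with a pointwise bound of the derivative by
a mollification of the weak derivative. -/
theorem exists_mollification {n m : ℕ} {Ω : Set (Euc n)} {f : Euc n → Euc m}
    {Df : Euc n → (Euc n →L[ℝ] Euc m)} (hf : ContinuousOn f Ω) (hDf : IsWeakFDerivOn Ω f Df)
    {x₀ : Euc n} {R : ℝ} (hR : 0 < R) (hball : closedBall x₀ (3 * R) ⊆ Ω) {η ε : ℝ} (hη : 0 < η)
    (hε : 0 < ε) :
    ∃ (u : Euc n → Euc m) (ρ : Euc n → ℝ≥0∞), ContDiff ℝ 1 u ∧ Measurable ρ ∧ ∫⁻ z, ρ z = 1 ∧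
      (∀ z, ρ z ≠ 0 → ‖z‖ < ε) ∧
      (∀ y ∈ closedBall x₀ (2 * R), dist (u y) (f y) ≤ η) ∧
      ∀ y ∈ closedBall x₀ (2 * R), ‖fderiv ℝ u y‖ₑ ≤ ∫⁻ z in Ω, ρ (y - z) * ‖Df z‖ₑ := by
  set K := closedBall x₀ (3 * R) with hK
  have hKc : IsCompact K := isCompact_closedBall _ _
  have hfK : ContinuousOn f K := hf.mono hball
  obtain ⟨δ, hδ, hδf⟩ := Metric.uniformContinuousOn_iff_le.1
    (hKc.uniformContinuousOn_of_continuous hfK) η hη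
  obtain ⟨e, he, heε, heδ, heR⟩ : ∃ e > 0, e ≤ ε ∧ e ≤ δ ∧ e ≤ R :=
    ⟨min ε (min δ R), by positivity, min_le_left _ _, (min_le_right _ _).trans (min_le_left _ _),
      (min_le_right _ _).trans (min_le_right _ _)⟩
  let β : ContDiffBump (0 : Euc n) := ⟨e / 2, e, by positivity, by linarith⟩
  have hβr : β.rOut = e := rfl
  set κ : Euc n → ℝ := β.normed volume with hκ
  have hκ0 : ∀ z, 0 ≤ κ z := fun z => β.nonneg_normed z
  have hκs : ∀ z, κ z ≠ 0 → ‖z‖ < e := fun z hz => by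
    have : z ∈ Function.support κ := hz
    rw [hκ, β.support_normed_eq, hβr] at this
    simpa using this
  have hκsm : ContDiff ℝ (⊤ : ℕ∞) κ := β.contDiff_normed
  have hκc : HasCompactSupport κ := β.hasCompactSupport_normed
  have hκd : Differentiable ℝ κ := hκsm.differentiable (by simp)
  set g : Euc n → Euc m := K.indicator f with hg
  have hgi : Integrable g := (integrable_indicator_iff hKc.measurableSet).2
    (hfK.integrableOn_compact hKc)
  have hsub : ∀ y ∈ closedBall x₀ (2 * R), ∀ z, ‖y - z‖ ≤ e → z ∈ K := by
    intro y hy z hz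
    rw [mem_closedBall] at hy ⊢
    rw [← dist_eq_norm, dist_comm] at hz
    linarith [dist_triangle z y x₀]
  refine ⟨convolution κ g (ContinuousLinearMap.lsmul ℝ ℝ) volume,
    fun z => ENNReal.ofReal (κ z), ?_, hκsm.continuous.measurable.ennreal_ofReal, ?_, ?_, ?_, ?_⟩
  · exact hκc.contDiff_convolution_left (n := 1) _ (hκsm.of_le (by exact_mod_cast le_top))
      hgi.locallyIntegrable
  · rw [← ofReal_integral_eq_lintegral_ofReal β.integrable_normed
      (Filter.Eventually.of_forall hκ0), β.integral_normed, ENNReal.ofReal_one]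
  · intro z hz
    exact (hκs z fun h => hz (by simp [h])).trans_le heε
  · intro y hy
    have hyK : y ∈ K := hsub y hy y (by simpa using he.le)
    rw [show f y = g y by rw [hg, indicator_of_mem hyK]]
    refine ContDiffBump.dist_normed_convolution_le hgi.aestronglyMeasurable fun z hz => ?_
    rw [hβr, mem_ball, dist_comm, dist_eq_norm] at hz
    have hzK : z ∈ K := hsub y hy z hz.le
    rw [hg, indicator_of_mem hyK, indicator_of_mem hzK]
    refine hδf z hzK y hyK ?_
    rw [dist_comm, dist_eq_norm]
    linarith
  · intro y hy
    have hfd := hκc.hasFDerivAt_convolution_left (ContinuousLinearMap.lsmul ℝ ℝ : ℝ →L[ℝ] _)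
      (hκsm.of_le (by exact_mod_cast le_top)) hgi.locallyIntegrable y
    rw [hfd.fderiv]
    set ψ : Euc n → ℝ := fun z => κ (y - z) with hψ
    have hψd : ∀ z v, fderiv ℝ ψ z v = - fderiv ℝ κ (y - z) v := fun z v => by
      have h1 : HasFDerivAt (fun z => y - z) (-(ContinuousLinearMap.id ℝ (Euc n))) z := by
        simpa using (hasFDerivAt_id z).const_sub y
      have h2 := (hκd (y - z)).hasFDerivAt.comp z h1
      rw [show ψ = κ ∘ fun z => y - z from rfl, h2.fderiv]
      simp
    have hψs : tsupport ψ ⊆ closedBall y e := by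
      refine closure_minimal (fun z hz => ?_) isClosed_closedBall
      rw [mem_closedBall, dist_comm, dist_eq_norm]
      exact (hκs _ hz).le
    have hyKe : closedBall y e ⊆ K := fun z hz => hsub y hy z (by
      rw [← dist_eq_norm, dist_comm]; exact hz)
    have hψsm : ContDiff ℝ (⊤ : ℕ∞) ψ := hκsm.comp (by fun_prop)
    have hψc : HasCompactSupport ψ :=
      (isCompact_closedBall y e).of_isClosed_subset (isClosed_tsupport ψ) hψs
    refine ContinuousLinearMap.opENorm_le_bound _ fun v => ?_
    have hval : (convolution (fderiv ℝ κ) g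
        ((ContinuousLinearMap.lsmul ℝ ℝ).precompL (Euc n)) volume y) v =
        ∫ z in Ω, ψ z • Df z v := by
      have hci := (hκc.fderiv (𝕜 := ℝ)).convolutionExists_left
        ((ContinuousLinearMap.lsmul ℝ ℝ : ℝ →L[ℝ] Euc m →L[ℝ] Euc m).precompL (Euc n))
        (hκsm.continuous_fderiv (by simp)) hgi.locallyIntegrable y
      rw [convolution_def, ContinuousLinearMap.integral_apply hci,
        ← integral_sub_left_eq_self _ volume y, hDf.2.2 ψ hψsm hψc (hψs.trans (hyKe.trans hball)) v,
        ← integral_neg]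
      have hzero : ∀ z, z ∉ K → fderiv ℝ ψ z v = 0 := fun z hz => by
        rw [image_eq_zero_of_notMem_tsupport (f := fderiv ℝ ψ)
          fun h => hz (hyKe (hψs (tsupport_fderiv_subset ℝ h)))]
        simp
      rw [← setIntegral_eq_integral_of_forall_compl_eq_zero (s := Ω)]
      · refine integral_congr_ae (Filter.Eventually.of_forall fun z => ?_)
        simp only [ContinuousLinearMap.precompL_apply, ContinuousLinearMap.lsmul_apply,
          show y - (y - z) = z by abel]
        by_cases hz : z ∈ K
        · rw [hg, indicator_of_mem hz, hψd]; simp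
        · have := hψd z v
          rw [hzero z hz] at this
          rw [hzero z hz, neg_eq_zero.1 this.symm]
          simp
      · intro z hz
        have hzK : z ∉ K := fun h => hz (hball h)
        simp [hg, hzK]
    rw [hval, ← lintegral_mul_const' _ _ enorm_ne_top]
    refine (enorm_integral_le_lintegral_enorm _).trans (lintegral_mono fun z => ?_)
    rw [enorm_smul, mul_assoc, hψ, Real.enorm_eq_ofReal (hκ0 _)]
    gcongr
    exact ContinuousLinearMap.le_opENorm _ _

/-! ### The key estimate -/

theorem convex_cube {n : ℕ} (x : Euc n) (s : ℝ) : Convex ℝ (cube x s) := by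
  have : cube x s = ⋂ i, (fun y : Euc n => y i) ⁻¹' Icc (x i - s) (x i + s) := by
    ext y
    simp only [cube, mem_ofPred_eq, mem_iInter, mem_preimage, mem_Icc, abs_le]
    exact forall_congr' fun i => ⟨fun h => ⟨by linarith, by linarith⟩,
      fun h => ⟨by linarith, by linarith⟩⟩
  rw [this]
  exact convex_iInter fun i =>
    (convex_Icc _ _).linear_preimage (EuclideanSpace.proj i : Euc n →L[ℝ] ℝ).toLinearMap

theorem lintegral_mollify_le {n : ℕ} {ρ G : Euc n → ℝ≥0∞} (hρ : Measurable ρ)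
    (hG : Measurable G) (hρ1 : ∫⁻ z, ρ z = 1) {ε : ℝ} (hρε : ∀ z, ρ z ≠ 0 → ‖z‖ < ε)
    {Ω S T : Set (Euc n)} (hT : MeasurableSet T)
    (hST : ∀ y ∈ S, ∀ z, ‖y - z‖ < ε → z ∈ T) (hS : MeasurableSet S) :
    ∫⁻ y in S, ∫⁻ z in Ω, ρ (y - z) * G z ≤ ∫⁻ z in T, G z := by
  have hm : Measurable fun p : Euc n × Euc n => ρ (p.1 - p.2) * G p.2 := by fun_prop
  rw [lintegral_lintegral_swap hm.aemeasurable]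
  calc ∫⁻ z in Ω, ∫⁻ y in S, ρ (y - z) * G z
      ≤ ∫⁻ z, ∫⁻ y in S, ρ (y - z) * G z := setLIntegral_le_lintegral _ _
    _ ≤ ∫⁻ z, T.indicator G z := by
        refine lintegral_mono fun z => ?_
        by_cases hz : z ∈ T
        · rw [indicator_of_mem hz, lintegral_mul_const _ (by fun_prop)]
          calc _ ≤ (∫⁻ y, ρ (y - z)) * G z := by
                gcongr
                exact Measure.restrict_le_self
            _ = G z := by rw [lintegral_sub_right_eq_self, hρ1, one_mul]
        · rw [indicator_of_notMem hz, nonpos_iff_eq_zero,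
            setLIntegral_congr_fun (g := fun _ => 0) hS, lintegral_zero]
          intro y hy
          have : ρ (y - z) = 0 := by
            by_contra h
            exact hz (hST y hy z (hρε _ h))
          simp [this]
    _ = ∫⁻ z in T, G z := lintegral_indicator hT _

/-- The oscillation of a `C¹` map on the boundary of a suitable cube. -/
theorem exists_edist_cubeBdry_le {k : ℕ} (hk : 2 ≤ k) {E : Type*} [NormedAddCommGroup E]
    [NormedSpace ℝ E] [CompleteSpace E] {u : Euc (k + 1) → E} (hu : ContDiff ℝ 1 u)
    {a c : ℕ → ℝ≥0∞} {h : ℕ → Euc (k + 1) → ℝ≥0∞} {A b N : ℝ≥0∞}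
    (hA : ∀ H : ℕ → ℝ≥0∞, ∑' j, a j * H j ^ (1 / (k : ℝ)) ≤
      A * (∑' j, c j * H j) ^ (1 / (k : ℝ)))
    (hm : ∀ j, Measurable (h j)) (h1 : ∀ j y, h j y ≤ 1) {x : Euc (k + 1)} {r : ℝ} (hr : 0 < r)
    (hq : ∀ y ∈ cube x (2 * r), ‖fderiv ℝ u y‖ₑ ≤ b + ∑' j, a j * h j y)
    (hN : ∫⁻ y in cube x (2 * r), ∑' j, c j * h j y ≤ N * ENNReal.ofReal r ^ (k + 1)) :
    ∃ s ∈ Ioc r (2 * r), ∀ p ∈ cubeBdry x s, ∀ q ∈ cubeBdry x s, edist (u p) (u q) ≤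
      4 * (2 * ENNReal.ofReal (4 * k * r) *
        (b + 2 * (A * (2 * (k + 1) * N) ^ (1 / (k : ℝ))))) := by
  have hΓ : Measurable fun y => ∑' j, c j * h j y :=
    Measurable.tsum fun j => (hm j).const_mul _
  obtain ⟨s, hs, hface⟩ := exists_lintegral_face_le x hΓ hr
  have hs0 : 0 < s := hr.trans hs.1
  refine ⟨s, hs, fun p hp q hq' => edist_le_of_cubeFace (by omega) hs0 ?_ hp hq'⟩
  intro i σ hσ p hp q hq'
  have hσ1 : |σ| = 1 := by
    simp only [Finset.mem_insert, Finset.mem_singleton] at hσ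
    rcases hσ with rfl | rfl <;> simp
  obtain ⟨v, hv, rfl⟩ := exists_facePoint_eq hs0 hp
  obtain ⟨w, hw, rfl⟩ := exists_facePoint_eq hs0 hq'
  set F : (Fin k → ℝ) → Euc (k + 1) := fun v => facePoint x i (s * σ) (s • v) with hF
  have hFm : Measurable F := by
    have h2 : Measurable fun v : Fin k → ℝ => (s * σ, s • v) := by fun_prop
    exact (measurable_facePoint x i).comp h2
  have hFc : ∀ v ∈ stdCube k, F v ∈ cube x s := fun v hv => by
    rw [hF, facePoint_mem_cube_iff]
    refine ⟨by rw [abs_mul, hσ1, abs_of_pos hs0, mul_one], fun j => ?_⟩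
    rw [Pi.smul_apply, smul_eq_mul, abs_mul, abs_of_pos hs0]
    exact mul_le_of_le_one_right hs0.le (abs_le.2 ⟨hv.1 j, hv.2 j⟩)
  have hFl : ∀ (v w : Fin k → ℝ) (t : ℝ), F (v + t • (w - v)) = F v + t • (F w - F v) := by
    intro v w t
    simp only [hF]
    rw [← facePoint_add_smul_sub, smul_add, smul_comm s t, smul_sub]
  have key := edist_le_of_segments hk (u := u ∘ F) (L := ENNReal.ofReal (4 * k * r)) (b := b)
    (a := a) (h := fun j v => h j (F v)) (fun j => (hm j).comp hFm) (fun j v => h1 j _) ?_ hv hw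
  · refine key.trans ?_
    gcongr
    refine (hA _).trans ?_
    gcongr
    have h4 : ∑' j, c j * ∫⁻ w in stdCube k, h j (F w) =
        ∫⁻ w in stdCube k, ∑' j, c j * h j (F w) := by
      have hmF : ∀ j, Measurable fun w => h j (F w) := fun j => (hm j).comp hFm
      rw [lintegral_tsum fun j => ((hmF j).const_mul (c j)).aemeasurable]
      exact tsum_congr fun j => (lintegral_const_mul _ (hmF j)).symm
    rw [h4]
    have h5 := (hface i σ hσ).trans (mul_le_mul_right hN (2 * ((k : ℝ≥0∞) + 1)))
    rw [← mul_assoc, mul_comm _ (ENNReal.ofReal r ^ (k + 1))] at h5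
    exact (ENNReal.mul_le_mul_iff_right (pow_ne_zero _ (by simpa using hr))
      (ENNReal.pow_ne_top ENNReal.ofReal_ne_top)).1 h5
  · intro v hv w hw
    refine (edist_le_lintegral_segment hu (convex_cube x s)
      (fun y hy => hq y fun i => (hy i).trans hs.2) (hFc v hv) (hFc w hw)).trans ?_
    simp only [hFl]
    gcongr
    rw [← ofReal_norm]
    refine ENNReal.ofReal_le_ofReal ((norm_facePoint_sub_le x i _ hs0.le hw hv).trans ?_)
    have := mul_le_mul_of_nonneg_left hs.2 (show (0 : ℝ) ≤ 2 * k by positivity)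
    linarith

/-- The oscillation of a continuous open Sobolev map near a point is controlled by the average of
the weights of the level sets of its gradient. -/
theorem edist_le_of_average_le {k : ℕ} (hk : 2 ≤ k) {Ω : Set (Euc (k + 1))}
    {f : Euc (k + 1) → Euc (k + 1)} {Df : Euc (k + 1) → (Euc (k + 1) →L[ℝ] Euc (k + 1))}
    (hf : ContinuousOn f Ω)
    (hopen : ∀ U : Set (Euc (k + 1)), IsOpen U → U ⊆ Ω → IsOpen (f '' U))
    (hDf : IsWeakFDerivOn Ω f Df)
    {a c : ℕ → ℝ≥0∞} {A b N : ℝ≥0∞} (hAtop : A ≠ ⊤) (hbtop : b ≠ ⊤) (hNtop : N ≠ ⊤)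
    (hA : ∀ H : ℕ → ℝ≥0∞, ∑' j, a j * H j ^ (1 / (k : ℝ)) ≤
      A * (∑' j, c j * H j) ^ (1 / (k : ℝ)))
    {e : ℕ → Euc (k + 1) → ℝ≥0∞} (he : ∀ j, Measurable (e j)) (he1 : ∀ j y, e j y ≤ 1)
    (hDe : ∀ᵐ z ∂(volume.restrict Ω), ‖Df z‖ₑ ≤ b + ∑' j, a j * e j z)
    {x₀ x : Euc (k + 1)} {r R : ℝ} (hball : closedBall x₀ (3 * R) ⊆ Ω)
    (hx : x ∈ ball x₀ R) (hr : 0 < r) (hrR : (2 * k + 3) * r ≤ R)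
    (hN : ∫⁻ y in closedBall x ((2 * k + 3) * r), ∑' j, c j * e j y ≤
      N * ENNReal.ofReal r ^ (k + 1)) {y : Euc (k + 1)} (hy : y ∈ cube x r) :
    edist (f y) (f x) ≤ (k + 1) * (4 * (2 * ENNReal.ofReal (4 * k * r) *
        (b + 2 * (A * (2 * (k + 1) * N) ^ (1 / (k : ℝ)))))) := by
  have hR : 0 < R := lt_of_lt_of_le (by positivity) hrR
  set M := 4 * (2 * ENNReal.ofReal (4 * k * r) *
        (b + 2 * (A * (2 * (k + 1) * N) ^ (1 / (k : ℝ))))) with hM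
  have hMtop : M ≠ ⊤ := by
    have : ((2 : ℝ≥0∞) * (k + 1) * N) ≠ ⊤ := by finiteness
    finiteness
  have hcube : ∀ s ≤ 2 * r, cube x s ⊆ closedBall x₀ (2 * R) := fun s hs z hz => by
    have h1 := cube_subset_closedBall x s hz
    rw [mem_closedBall] at h1 ⊢
    rw [mem_ball] at hx
    have h2 : ((k + 1 : ℕ) : ℝ) * s ≤ (k + 1 : ℕ) * (2 * r) := by gcongr
    push_cast at h1 h2
    nlinarith [dist_triangle z x x₀]
  have hcubeΩ : ∀ s ≤ 2 * r, cube x s ⊆ Ω := fun s hs =>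
    (hcube s hs).trans ((closedBall_subset_closedBall (by linarith)).trans hball)
  have hclose : ∀ η : ℝ, 0 < η → ‖f y - f x‖ ≤ (k + 1 : ℕ) * (M.toReal + 2 * η) := by
    intro η hη
    obtain ⟨u, ρ, hu, hρm, hρ1, hρr, huf, hfd⟩ := exists_mollification hf hDf hR hball hη hr
    have hm : ∀ j, Measurable fun p : Euc (k + 1) × Euc (k + 1) => ρ (p.1 - p.2) * e j p.2 :=
      fun j => (hρm.comp measurable_sub).mul ((he j).comp measurable_snd)
    have hmy : ∀ (y : Euc (k + 1)) j, Measurable fun z => ρ (y - z) * e j z := fun y j => by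
      have := he j
      fun_prop
    set h : ℕ → Euc (k + 1) → ℝ≥0∞ := fun j y => ∫⁻ z in Ω, ρ (y - z) * e j z with hh
    have hρΩ : ∀ y, ∫⁻ z in Ω, ρ (y - z) ≤ 1 := fun y =>
      (setLIntegral_le_lintegral _ _).trans (by rw [lintegral_sub_left_eq_self, hρ1])
    have h1 : ∀ j y, h j y ≤ 1 := fun j y =>
      (lintegral_mono fun z => mul_le_of_le_one_right' (he1 j z)).trans (hρΩ y)
    have hsum : ∀ (d : ℕ → ℝ≥0∞) y,
        ∫⁻ z in Ω, ρ (y - z) * ∑' j, d j * e j z = ∑' j, d j * h j y := fun d y => by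
      simp only [← ENNReal.tsum_mul_left, mul_left_comm (ρ _)]
      rw [lintegral_tsum fun j => ((hmy y j).const_mul _).aemeasurable]
      exact tsum_congr fun j => lintegral_const_mul _ (hmy y j)
    have hq : ∀ y ∈ cube x (2 * r), ‖fderiv ℝ u y‖ₑ ≤ b + ∑' j, a j * h j y := by
      intro y hy
      refine (hfd y (hcube _ le_rfl hy)).trans ?_
      rw [← hsum]
      calc ∫⁻ z in Ω, ρ (y - z) * ‖Df z‖ₑ
          ≤ ∫⁻ z in Ω, (ρ (y - z) * b + ρ (y - z) * ∑' j, a j * e j z) := by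
            refine lintegral_mono_ae (hDe.mono fun z hz => ?_)
            rw [← mul_add]
            gcongr
        _ = (∫⁻ z in Ω, ρ (y - z)) * b + ∫⁻ z in Ω, ρ (y - z) * ∑' j, a j * e j z := by
            rw [lintegral_add_left (by fun_prop), lintegral_mul_const _ (by fun_prop)]
        _ ≤ _ := by
            gcongr
            exact mul_le_of_le_one_left' (hρΩ y)
    have hΓ : ∫⁻ y in cube x (2 * r), ∑' j, c j * h j y ≤ N * ENNReal.ofReal r ^ (k + 1) := by
      simp only [← hsum]
      refine (lintegral_mollify_le hρm (Measurable.tsum fun j => (he j).const_mul _) hρ1 hρr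
        isClosed_closedBall.measurableSet ?_ (isClosed_cube _ _).measurableSet).trans hN
      intro y hy z hz
      have h2 := cube_subset_closedBall x _ hy
      rw [mem_closedBall] at h2 ⊢
      rw [← dist_eq_norm, dist_comm] at hz
      push_cast at h2
      linarith [dist_triangle z y x]
    obtain ⟨s, hs, hosc⟩ := exists_edist_cubeBdry_le (b := b) (N := N) (h := h) (x := x) hk hu hA
      (fun j => (hm j).lintegral_prod_right') h1 hr hq hΓ
    have hn := norm_sub_le_of_cubeBdry (f := f) (x := x) (s := s) (M := M.toReal + 2 * η)
      (hf.mono (hcubeΩ s hs.2)) (fun U hU hUs => hopen U hU (hUs.trans (hcubeΩ s hs.2))) ?_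
      (p := y) (q := x) (fun i => (hy i).trans hs.1.le)
      (fun i => by simpa using (hr.trans hs.1).le)
    · exact hn
    · intro p hp q hq
      have h3 := huf p (hcube s hs.2 hp.1)
      have h4 := huf q (hcube s hs.2 hq.1)
      have h5 : dist (u p) (u q) ≤ M.toReal := by
        rw [dist_edist]
        exact ENNReal.toReal_mono hMtop (hosc p hp q hq)
      rw [← dist_eq_norm]
      rw [dist_comm] at h3
      linarith [dist_triangle4 (f p) (u p) (u q) (f q)]
  have hle : ‖f y - f x‖ ≤ (k + 1 : ℕ) * M.toReal := by
    refine le_of_forall_pos_le_add fun η hη => ?_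
    refine (hclose (η / (2 * (k + 1 : ℕ))) (by positivity)).trans_eq ?_
    push_cast
    field_simp
  rw [edist_eq_enorm_sub, ← ofReal_norm]
  refine (ENNReal.ofReal_le_ofReal hle).trans_eq ?_
  rw [ENNReal.ofReal_mul (by positivity), ENNReal.ofReal_toReal hMtop, ENNReal.ofReal_natCast]
  push_cast
  rfl

/-! ### Level sets of the gradient and conclusion -/

theorem opNorm_le_frobNorm {n m : ℕ} (A : Euc n →L[ℝ] Euc m) : ‖A‖ ≤ frobNorm A := by
  refine A.opNorm_le_bound (Real.sqrt_nonneg _) fun v => ?_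
  rw [frobNorm, EuclideanSpace.norm_eq, EuclideanSpace.norm_eq, ← Real.sqrt_mul (by positivity)]
  refine Real.sqrt_le_sqrt ?_
  simp only [Real.norm_eq_abs, sq_abs]
  rw [Finset.sum_mul]
  refine Finset.sum_le_sum fun i _ => ?_
  have hv : A v i = ∑ j, A (EuclideanSpace.single j 1) i * v j := by
    conv_lhs => rw [← (EuclideanSpace.basisFun (Fin n) ℝ).sum_repr v]
    simp [mul_comm]
  rw [hv]
  exact Finset.sum_mul_sq_le_sq_mul_sq _ _ _

theorem continuous_frobNorm {n m : ℕ} :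
    Continuous (frobNorm : (Euc n →L[ℝ] Euc m) → ℝ) := by
  unfold frobNorm
  fun_prop

/-- Dyadic level sets of the gradient of an Orlicz–Sobolev map. -/
theorem exists_levelSets {n : ℕ} {Ω : Set (Euc n)} {φ : ℝ → ℝ}
    (hφ : MonotoneOn φ (Ici 0)) {Df : Euc n → (Euc n →L[ℝ] Euc n)}
    (hDf : LocallyIntegrableOn Df Ω volume) :
    ∃ e : ℕ → Euc n → ℝ≥0∞, (∀ j, Measurable (e j)) ∧ (∀ j y, e j y ≤ 1) ∧
      (∀ᵐ z ∂(volume.restrict Ω), ‖Df z‖ₑ ≤ 2 + ∑' j, 2 ^ (j + 2) * e j z) ∧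
      ∀ᵐ z ∂(volume.restrict Ω), ∑' j, ENNReal.ofReal (φ (2 ^ (j + 1))) * e j z ≤
        ENNReal.ofReal (φ (frobNorm (Df z))) := by
  have hD := hDf.aestronglyMeasurable
  set D := hD.mk Df with hDdef
  have hDm : Measurable fun z => frobNorm (D z) :=
    (continuous_frobNorm.comp_stronglyMeasurable hD.stronglyMeasurable_mk).measurable
  set S : ℕ → Set (Euc n) := fun j => {z | frobNorm (D z) ∈ Ico ((2 : ℝ) ^ (j + 1)) (2 ^ (j + 2))}
    with hS
  have hSm : ∀ j, MeasurableSet (S j) := fun j => hDm measurableSet_Ico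
  have huniq : ∀ z i j, z ∈ S i → z ∈ S j → i ≤ j := fun z i j hi hj => by
    have h1 : (2 : ℝ) ^ (i + 1) < 2 ^ (j + 2) := hi.1.trans_lt hj.2
    have h2 := (pow_lt_pow_iff_right₀ (one_lt_two : (1 : ℝ) < 2)).1 h1
    omega
  refine ⟨fun j => (S j).indicator fun _ => 1, fun j => measurable_const.indicator (hSm j),
    fun j y => indicator_le_self' (fun _ _ => zero_le) y, ?_, ?_⟩
  · filter_upwards [hD.ae_eq_mk] with z hz
    have h1 : ‖Df z‖ₑ ≤ ENNReal.ofReal (frobNorm (D z)) := by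
      rw [hz, ← ofReal_norm]
      exact ENNReal.ofReal_le_ofReal (opNorm_le_frobNorm _)
    refine h1.trans ?_
    by_cases h2 : frobNorm (D z) < 2
    · refine le_add_right ?_
      exact (ENNReal.ofReal_le_ofReal h2.le).trans_eq (by simp)
    · obtain ⟨j, hj1, hj2⟩ := exists_nat_pow_near (x := frobNorm (D z) / 2) (y := (2 : ℝ))
        (by linarith) one_lt_two
      have hzS : z ∈ S j :=
        ⟨by rw [pow_succ]; linarith, by rw [pow_succ]; linarith⟩
      refine le_add_left (le_trans ?_ (ENNReal.le_tsum j))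
      rw [indicator_of_mem hzS, mul_one]
      refine (ENNReal.ofReal_le_ofReal hzS.2.le).trans_eq ?_
      rw [ENNReal.ofReal_pow zero_le_two, ENNReal.ofReal_ofNat]
  · filter_upwards [hD.ae_eq_mk] with z hz
    rw [hz]
    by_cases hj : ∃ j, z ∈ S j
    · obtain ⟨j, hj⟩ := hj
      rw [tsum_eq_single j, indicator_of_mem hj, mul_one]
      · exact ENNReal.ofReal_le_ofReal (hφ (show (0 : ℝ) ≤ 2 ^ (j + 1) by positivity)
          (Real.sqrt_nonneg _) hj.1)
      · intro i hij
        rw [indicator_of_notMem, mul_zero]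
        exact fun hi => hij ((huniq z i j hi hj).antisymm (huniq z j i hj hi))
    · push Not at hj
      simp [hj]

/-- A locally integrable density has averages which are bounded as the radius tends to zero. -/
theorem ae_eventually_average_le {n : ℕ} {G : Euc n → ℝ≥0∞} {K : Set (Euc n)}
    (hK : MeasurableSet K) (hGK : ∫⁻ z in K, G z ≠ ⊤) {C : ℝ} (hC : 0 < C) :
    ∀ᵐ x ∂(volume : Measure (Euc n)), ∃ N : ℝ≥0∞, N ≠ ⊤ ∧ ∃ δ : ℝ, 0 < δ ∧ ∀ r, 0 < r → r < δ →
      closedBall x (C * r) ⊆ K → ∫⁻ z in closedBall x (C * r), G z ≤ N * ENNReal.ofReal r ^ n := by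
  set ρ := volume.withDensity (K.indicator G) with hρ
  have : IsFiniteMeasure ρ := isFiniteMeasure_withDensity (by rwa [lintegral_indicator hK])
  filter_upwards [Besicovitch.ae_tendsto_rnDeriv ρ volume, Measure.rnDeriv_lt_top ρ volume]
    with x hx hxt
  obtain ⟨B, hB, hBt⟩ := exists_between hxt
  have h1 := (hx.eventually_lt_const hB)
  rw [eventually_nhdsWithin_iff, Metric.eventually_nhds_iff] at h1
  obtain ⟨δ, hδ, h1⟩ := h1
  refine ⟨B * (ENNReal.ofReal C ^ n * volume (ball (0 : Euc n) 1)), ?_, δ / C, by positivity, ?_⟩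
  · have : volume (ball (0 : Euc n) 1) ≠ ⊤ := measure_ball_lt_top.ne
    finiteness
  intro r hr hrδ hrK
  have hCr : 0 < C * r := by positivity
  have h2 := h1 (y := C * r) (by
    rw [Real.dist_eq, sub_zero, abs_of_pos hCr]
    rwa [lt_div_iff₀' hC] at hrδ) hCr
  rw [ENNReal.div_lt_iff (Or.inl (measure_closedBall_pos _ _ hCr).ne')
    (Or.inl measure_closedBall_lt_top.ne), Measure.addHaar_closedBall volume _ hCr.le,
    hρ, withDensity_apply _ isClosed_closedBall.measurableSet, setLIntegral_indicator hK,
    inter_eq_right.2 hrK] at h2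
  refine h2.le.trans_eq ?_
  rw [finrank_euclideanSpace_fin, ENNReal.ofReal_pow hCr.le, ENNReal.ofReal_mul hC.le, mul_pow]
  ring

theorem ae_linear_growth {k : ℕ} (hk : 2 ≤ k) {Ω : Set (Euc (k + 1))} (hΩ : IsOpen Ω)
    {φ : ℝ → ℝ} (hφ : MonotoneOn φ (Ici 0)) (hC : CalderonCondition (k + 1) φ)
    {f : Euc (k + 1) → Euc (k + 1)} (hf : ContinuousOn f Ω)
    (hopen : ∀ U : Set (Euc (k + 1)), IsOpen U → U ⊆ Ω → IsOpen (f '' U))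
    {Df : Euc (k + 1) → (Euc (k + 1) →L[ℝ] Euc (k + 1))}
    (hDf : MemOrliczSobolevWith φ Ω f Df) :
    ∀ᵐ x ∂(volume : Measure (Euc (k + 1))), x ∈ Ω →
      ∃ C δ : ℝ, 0 < δ ∧ ∀ y ∈ ball x δ, ‖f y - f x‖ ≤ C * ‖y - x‖ := by
  obtain ⟨A, hAtop, hA⟩ := exists_calderon_constant hk hφ hC
  obtain ⟨e, he, he1, hDe, hGe⟩ := exists_levelSets hφ hDf.1.2.1
  rw [ae_iff]
  refine measure_null_of_locally_null _ fun x₀ hx₀ => ?_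
  have hx₀Ω : x₀ ∈ Ω := by
    by_contra h
    exact hx₀ fun h' => absurd h' h
  obtain ⟨ε, hε, hεΩ⟩ := Metric.nhds_basis_closedBall.mem_iff.1 (hΩ.mem_nhds hx₀Ω)
  obtain ⟨R, hR, rfl⟩ : ∃ R > 0, ε = 3 * R := ⟨ε / 3, by positivity, by ring⟩
  refine ⟨_, inter_mem_nhdsWithin _ (ball_mem_nhds x₀ hR), ?_⟩
  have hGK : ∫⁻ z in closedBall x₀ (3 * R),
      ∑' j, ENNReal.ofReal (φ (2 ^ (j + 1))) * e j z ≠ ⊤ :=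
    ((lintegral_mono_ae (ae_restrict_of_ae_restrict_of_subset hεΩ hGe)).trans_lt
      (hDf.2 _ hεΩ (isCompact_closedBall _ _))).ne
  have key := ae_eventually_average_le isClosed_closedBall.measurableSet hGK
    (show (0 : ℝ) < 2 * k + 3 by positivity)
  refine measure_mono_null (fun x hx => ?_) (ae_iff.1 key)
  obtain ⟨hx, hxR⟩ := hx
  intro hN
  refine hx fun _ => ?_
  obtain ⟨N, hNtop, δ, hδ, hN⟩ := hN
  set P : ℝ≥0∞ := (k + 1) * (4 * (2 * ENNReal.ofReal (4 * k) *
    (2 + 2 * (A * (2 * (k + 1) * N) ^ (1 / (k : ℝ)))))) with hP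
  have hPtop : P ≠ ⊤ := by
    have : ((2 : ℝ≥0∞) * (k + 1) * N) ≠ ⊤ := by finiteness
    finiteness
  refine ⟨P.toReal, min δ (R / (2 * k + 3)), by positivity, fun y hy => ?_⟩
  rcases eq_or_ne y x with rfl | hyx
  · simp
  rw [mem_ball, dist_eq_norm, lt_min_iff] at hy
  have hr : 0 < ‖y - x‖ := norm_pos_iff.2 (sub_ne_zero.2 hyx)
  have hrR : (2 * k + 3) * ‖y - x‖ ≤ R := by
    have := hy.2.le
    rwa [le_div_iff₀' (by positivity)] at this
  have hsub : closedBall x ((2 * k + 3) * ‖y - x‖) ⊆ closedBall x₀ (3 * R) := fun z hz => by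
    rw [mem_closedBall] at hz ⊢
    rw [mem_ball] at hxR
    linarith [dist_triangle z x x₀]
  have hmain := edist_le_of_average_le hk hf hopen hDf.1 hAtop ENNReal.ofNat_ne_top hNtop hA he
    he1 hDe hεΩ hxR hr hrR (hN _ hr hy.1 hsub)
    (y := y) (fun i => Euc.abs_apply_le_norm (y - x) i)
  have hPr : edist (f y) (f x) ≤ P * ENNReal.ofReal ‖y - x‖ := by
    refine hmain.trans_eq ?_
    rw [hP, ENNReal.ofReal_mul (by positivity)]
    ring
  rw [edist_dist, dist_eq_norm] at hPr
  have := ENNReal.toReal_mono (by finiteness) hPr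
  rwa [ENNReal.toReal_mul, ENNReal.toReal_ofReal (norm_nonneg _),
    ENNReal.toReal_ofReal (norm_nonneg _)] at this

theorem stmt0 {n : ℕ} (hn : 3 ≤ n) (Ω : Set (Euc n)) (hΩ : IsOpen Ω)
    (φ : ℝ → ℝ) (hφmono : MonotoneOn φ (Ici 0)) (hφpos : ∀ t ∈ Ici (0:ℝ), 0 ≤ φ t)
    (hCald : CalderonCondition n φ)
    (f : Euc n → Euc n) (hfc : ContinuousOn f Ω)
    (hfopen : ∀ U : Set (Euc n), IsOpen U → U ⊆ Ω → IsOpen (f '' U))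
    (hfW : ∃ Df, MemOrliczSobolevWith φ Ω f Df) :
    ∀ᵐ x ∂(volume : Measure (Euc n)), x ∈ Ω → DifferentiableAt ℝ f x := by
  obtain ⟨Df, hDf⟩ := hfW
  obtain ⟨k, rfl⟩ : ∃ k, n = k + 1 := ⟨n - 1, by omega⟩
  filter_upwards [ae_linear_growth (by omega) hΩ hφmono hCald hfc hfopen hDf,
    ae_differentiableAt_of_linear_growth volume f] with x hx hdiff hxΩ
  exact hdiff (hx hxΩ)
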